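/- arXiv:0903.3547 — 3 statements merged into one kernel-verified Lean document; each statement's English description precedes it below -/
import Mathlib

section
/- Let z ∈ ℂ and let v ∈ ℓ²(Γ_d) be radial. Then ⟨v, (J − conj(z)·I)χ_n⟩ = 0 for every n ≥ 0 if and only if v satisfies the Jacobi eigen-equation Jv = z·v at every vertex of Γ_d. Consequently every radial element of the deficiency space of the restricted (radial) operator J^r lies in the deficiency space N_z(J) of J. -/
/-- The Jacobi operator `J` on the homogeneous rooted tree `Γ_d` (vertices = finite
words over `Fin d`). -/
noncomputable def jacobiOp (d : ℕ) (lam beta : ℕ → ℝ) (f : List (Fin d) → ℂ)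
    (x : List (Fin d)) : ℂ :=
  (if x = [] then 0 else (lam (x.length - 1) : ℂ) * f x.dropLast)
    + (beta x.length : ℂ) * f x
    + (lam x.length : ℂ) * ∑ i : Fin d, f (x ++ [i])

/-- `v` satisfies the Jacobi eigen-equation `Jv = z·v` at every vertex of `Γ_d`. -/
def JacobiEq (d : ℕ) (lam beta : ℕ → ℝ) (z : ℂ) (v : List (Fin d) → ℂ) : Prop :=
  ∀ x : List (Fin d), z * v x = jacobiOp d lam beta v x

/-- A function on `Γ_d` is radial if its value depends only on the length. -/
def Radial (d : ℕ) (f : List (Fin d) → ℂ) : Prop :=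
  ∀ x y : List (Fin d), x.length = y.length → f x = f y

/-- The indicator function `χ_n` of the `n`-th level of `Γ_d`. -/
def levelIndicator (d n : ℕ) : List (Fin d) → ℂ :=
  fun x => if x.length = n then 1 else 0

/-- A function vanishing off level `k`, and constantly `c` on it, sums to `d ^ k * c`. -/
lemma hasSum_level (d k : ℕ) (c : ℂ) :
    HasSum (fun x : List (Fin d) => if x.length = k then c else 0) ((d : ℂ) ^ k * c) := by
  have h : HasSum (fun _ : List.Vector (Fin d) k => c) ((d : ℂ) ^ k * c) := by
    simpa [card_vector] using hasSum_fintype (fun _ : List.Vector (Fin d) k => c)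
  have h' := (hasSum_subtype_iff_indicator (f := fun _ : List (Fin d) => c)
    (s := {x | x.length = k})).mp h
  convert h' using 1
  ext x
  simp [Set.indicator_apply]

/-- The action of the Jacobi operator on radial functions, in terms of the radial profile. -/
noncomputable def radialJacobiOp (d : ℕ) (lam beta : ℕ → ℝ) (a : ℕ → ℂ) (n : ℕ) : ℂ :=
  (if n = 0 then 0 else (lam (n - 1) : ℂ) * a (n - 1)) + (beta n : ℂ) * a n
    + (lam n : ℂ) * ((d : ℂ) * a (n + 1))

lemma jacobiOp_comp_length (d : ℕ) (lam beta : ℕ → ℝ) (a : ℕ → ℂ) (x : List (Fin d)) :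
    jacobiOp d lam beta (fun y => a y.length) x = radialJacobiOp d lam beta a x.length := by
  simp [jacobiOp, radialJacobiOp]

/-- For `v` radial with profile `a`, the pairing `⟨v, (J - conj z · I) χ_n⟩` is `d ^ n` times the
conjugate of the defect of the radial eigen-equation at `n`. -/
lemma hasSum_pairing_levelIndicator (d : ℕ) (lam beta : ℕ → ℝ) (z : ℂ) (a : ℕ → ℂ) (n : ℕ) :
    HasSum (fun x : List (Fin d) => (starRingEnd ℂ) (a x.length) *
        (jacobiOp d lam beta (levelIndicator d n) x
          - (starRingEnd ℂ) z * levelIndicator d n x))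
      ((d : ℂ) ^ n * (starRingEnd ℂ) (radialJacobiOp d lam beta a n - z * a n)) := by
  have key := ((hasSum_level d (n + 1) ((starRingEnd ℂ) (a (n + 1)) * lam n)).add
    (hasSum_level d n ((starRingEnd ℂ) (a n) * (beta n - (starRingEnd ℂ) z))))
  have hJ (x : List (Fin d)) : jacobiOp d lam beta (levelIndicator d n) x =
      radialJacobiOp d lam beta (fun k => if k = n then 1 else 0) x.length :=
    jacobiOp_comp_length d lam beta (fun k => if k = n then 1 else 0) x
  simp only [hJ, levelIndicator]
  cases n with
  | zero =>
    convert key using 1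
    · ext x
      rcases x.length with _ | _ | k <;> simp [radialJacobiOp]
    · simp [radialJacobiOp]
      ring
  | succ m =>
    convert key.add (hasSum_level d m ((starRingEnd ℂ) (a m) * (lam m * d))) using 1
    · ext x
      generalize x.length = k
      by_cases h₀ : k = m
      · subst h₀
        by_cases hk : k = 0 <;> simp [radialJacobiOp, hk] <;> grind
      by_cases h₁ : k = m + 1
      · subst h₁
        simp [radialJacobiOp]
      by_cases h₂ : k = m + 1 + 1
      · subst h₂
        simp [radialJacobiOp, h₀]
      · have h₃ : k - 1 ≠ m + 1 := by omega
        simp [radialJacobiOp, h₀, h₁, h₂, h₃]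
    · simp [radialJacobiOp]
      ring

/-- For a radial `v ∈ ℓ²(Γ_d)`, `⟨v, (J - conj z · I) χ_n⟩ = 0` for every `n ≥ 0`
if and only if `v` satisfies the Jacobi eigen-equation `Jv = z·v` at every vertex;
consequently every radial element of the deficiency space of the radial operator `J^r`
lies in the deficiency space `N_z(J)`. -/
theorem stmt1 (d : ℕ) (hd : 2 ≤ d) (lam beta : ℕ → ℝ) (hlam : ∀ n, 0 < lam n)
    (z : ℂ) (v : lp (fun _ : List (Fin d) => ℂ) 2)
    (hrad : Radial d (fun x => v x)) :
    (∀ n : ℕ,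
      ∑' x : List (Fin d),
        (starRingEnd ℂ) (v x) *
          (jacobiOp d lam beta (levelIndicator d n) x
            - (starRingEnd ℂ) z * levelIndicator d n x) = 0)
    ↔ JacobiEq d lam beta z (fun x => v x) := by
  have hd₀ : 0 < d := by omega
  obtain ⟨a, ha⟩ : ∃ a : ℕ → ℂ, ∀ x, v x = a x.length :=
    ⟨fun k => v (List.replicate k ⟨0, hd₀⟩), fun x => hrad _ _ (by simp)⟩
  have hdC : (d : ℂ) ≠ 0 := by exact_mod_cast hd₀.ne'
  simp only [JacobiEq, ha, jacobiOp_comp_length,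
    (hasSum_pairing_levelIndicator d lam beta z a _).tsum_eq, mul_eq_zero, pow_eq_zero_iff',
    hdC, false_and, false_or, map_eq_zero, sub_eq_zero]
  refine ⟨fun h x => (h x.length).symm, fun h n => ?_⟩
  simpa using (h (List.replicate n ⟨0, hd₀⟩)).symm
end

section
/- Let z ∈ ℂ with Im z ≠ 0. There exists a nonzero v ∈ ℓ²(Γ_d) satisfying the Jacobi eigen-equation Jv = z·v at every vertex of Γ_d if and only if there exists a nonzero square-summable sequence a : ℕ → ℂ satisfying z·a_n = √d·λ_{n−1}·a_{n−1} + β_n·a_n + √d·λ_n·a_{n+1} for all n ≥ 0 (with the convention a_{−1} = 0). (Equivalently: the Jacobi operator J on ℓ²(Γ_d) is essentially selfadjoint if and only if the classical one-dimensional Jacobi matrix J^r with diagonal entries β_n and off-diagonal entries √d·λ_n is essentially selfadjoint.) -/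
open Finset in
/-- Green's identity for solutions of a three-term recurrence with real coefficients. -/
theorem jacobi_green {c b : ℕ → ℝ} {z : ℂ} {u : ℕ → ℂ}
    (hu : ∀ n, z * u (n + 1) = c n * u n + b n * u (n + 1) + c (n + 1) * u (n + 2)) (N : ℕ) :
    z.im * ∑ n ∈ range N, ‖u (n + 1)‖ ^ 2 =
      c N * (u (N + 1) * starRingEnd ℂ (u N)).im - c 0 * (u 1 * starRingEnd ℂ (u 0)).im := by
  induction N with
  | zero => simp
  | succ N ih =>
    rw [sum_range_succ, mul_add, ih]
    have hre := congrArg Complex.re (hu N)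
    have him := congrArg Complex.im (hu N)
    simp only [Complex.add_re, Complex.add_im, Complex.mul_re, Complex.mul_im, Complex.ofReal_re,
      Complex.ofReal_im, zero_mul, sub_zero, add_zero] at hre him
    simp only [Complex.sq_norm, Complex.normSq_apply, Complex.mul_im, Complex.conj_re,
      Complex.conj_im]
    linear_combination (u (N + 1)).re * him - (u (N + 1)).im * hre

open Finset in
/-- A solution vanishing at `0` but not at `1` never vanishes again, for nonreal `z`. -/
theorem jacobi_solution_ne_zero {c b : ℕ → ℝ} {z : ℂ} (hz : z.im ≠ 0) {u : ℕ → ℂ}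
    (hu : ∀ n, z * u (n + 1) = c n * u n + b n * u (n + 1) + c (n + 1) * u (n + 2))
    (hu0 : u 0 = 0) (hu1 : u 1 ≠ 0) (N : ℕ) : u (N + 1) ≠ 0 := by
  intro h
  have hg := jacobi_green hu N
  rw [h, hu0] at hg
  simp only [zero_mul, Complex.zero_im, map_zero, mul_zero, sub_zero, mul_eq_zero, hz,
    false_or] at hg
  rw [sum_eq_zero_iff_of_nonneg (fun _ _ => by positivity)] at hg
  cases N with
  | zero => exact hu1 h
  | succ N =>
    have := hg 0 (by simp)
    simp only [zero_add] at this
    exact hu1 (by simpa using this)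

open Finset in
/-- If, for nonreal `z`, the solution vanishing at `0` is square-summable, then so is every
solution of the recurrence. -/
theorem jacobi_summable_of_summable {c b : ℕ → ℝ} {z : ℂ} (hz : z.im ≠ 0) {u a : ℕ → ℂ}
    (hu : ∀ n, z * u (n + 1) = c n * u n + b n * u (n + 1) + c (n + 1) * u (n + 2))
    (hu0 : u 0 = 0) (hu1 : u 1 ≠ 0) (hus : Summable fun n => ‖u (n + 1)‖ ^ 2)
    (ha : ∀ n, z * a (n + 1) = c n * a n + b n * a (n + 1) + c (n + 1) * a (n + 2)) :
    Summable fun n => ‖a (n + 1)‖ ^ 2 := by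
  set K : ℝ := |c 0| * ‖a 0‖ / |z.im| with hK
  have hzpos : 0 < |z.im| := abs_pos.mpr hz
  have hK0 : 0 ≤ K := by positivity
  set M : ℝ := (‖a 1‖ + K) / ‖u 1‖ with hM
  have hu1pos : 0 < ‖u 1‖ := norm_pos_iff.mpr hu1
  have hM0 : 0 ≤ M := by positivity
  have key : ∀ N, ∑ n ∈ range (N + 1), ‖a (n + 1)‖ ^ 2 ≤
      2 * K ^ 2 + 2 * M ^ 2 * ∑' n, ‖u (n + 1)‖ ^ 2 := by
    intro N
    have hne := jacobi_solution_ne_zero hz hu hu0 hu1 (N + 1)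
    set w := a (N + 1 + 1) / u (N + 1 + 1) with hw
    have hs : ∀ n, z * (a (n + 1) - w * u (n + 1)) = c n * (a n - w * u n)
        + b n * (a (n + 1) - w * u (n + 1)) + c (n + 1) * (a (n + 2) - w * u (n + 2)) := by
      intro n
      linear_combination ha n - w * hu n
    have hg := jacobi_green (u := fun n => a n - w * u n) hs (N + 1)
    have hzero : a (N + 1 + 1) - w * u (N + 1 + 1) = 0 := by
      rw [hw, div_mul_cancel₀ _ hne, sub_self]
    simp only [hzero, hu0, zero_mul, mul_zero, sub_zero, Complex.zero_im, zero_sub] at hg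
    set S := ∑ n ∈ range (N + 1), ‖a (n + 1) - w * u (n + 1)‖ ^ 2 with hS
    set t := ‖a 1 - w * u 1‖ with ht
    have hS0 : 0 ≤ S := sum_nonneg fun _ _ => by positivity
    have hSt : S ≤ K * t := by
      have h1 : |z.im| * S ≤ |c 0| * (t * ‖a 0‖) := by
        calc |z.im| * S = |z.im * S| := by rw [abs_mul, abs_of_nonneg hS0]
          _ = |c 0| * |((a 1 - w * u 1) * starRingEnd ℂ (a 0)).im| := by
              rw [hg, abs_neg, abs_mul]
          _ ≤ |c 0| * (t * ‖a 0‖) := by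
              gcongr
              refine (Complex.abs_im_le_norm _).trans ?_
              rw [norm_mul, RCLike.norm_conj]
      rw [hK, div_mul_eq_mul_div, le_div_iff₀ hzpos]
      linarith
    have htS : t ^ 2 ≤ S :=
      single_le_sum (f := fun n => ‖a (n + 1) - w * u (n + 1)‖ ^ 2)
        (fun _ _ => by positivity) (mem_range.mpr (Nat.succ_pos N))
    have ht0 : 0 ≤ t := norm_nonneg _
    have htK : t ≤ K := by
      by_contra! h
      nlinarith
    have hSK : S ≤ K ^ 2 := by nlinarith
    have hwM : ‖w‖ ≤ M := by
      rw [hM, le_div_iff₀ hu1pos, ← norm_mul]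
      calc ‖w * u 1‖ = ‖a 1 - (a 1 - w * u 1)‖ := by congr 1; ring
        _ ≤ ‖a 1‖ + t := norm_sub_le _ _
        _ ≤ ‖a 1‖ + K := by gcongr
    calc ∑ n ∈ range (N + 1), ‖a (n + 1)‖ ^ 2
        ≤ ∑ n ∈ range (N + 1),
            (2 * ‖a (n + 1) - w * u (n + 1)‖ ^ 2 + 2 * M ^ 2 * ‖u (n + 1)‖ ^ 2) := by
          refine sum_le_sum fun n _ => ?_
          have h1 : ‖a (n + 1)‖ ≤ ‖a (n + 1) - w * u (n + 1)‖ + M * ‖u (n + 1)‖ := by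
            calc ‖a (n + 1)‖ = ‖(a (n + 1) - w * u (n + 1)) + w * u (n + 1)‖ := by congr 1; ring
              _ ≤ ‖a (n + 1) - w * u (n + 1)‖ + ‖w * u (n + 1)‖ := norm_add_le _ _
              _ ≤ _ := by rw [norm_mul]; gcongr
          have h2 := pow_le_pow_left₀ (norm_nonneg _) h1 2
          nlinarith [sq_nonneg (‖a (n + 1) - w * u (n + 1)‖ - M * ‖u (n + 1)‖)]
      _ = 2 * S + 2 * M ^ 2 * ∑ n ∈ range (N + 1), ‖u (n + 1)‖ ^ 2 := by
          rw [sum_add_distrib, ← mul_sum, ← mul_sum]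
      _ ≤ _ := by
          gcongr
          exact hus.sum_le_tsum _ fun _ _ => by positivity
  refine summable_of_sum_range_le (c := 2 * K ^ 2 + 2 * M ^ 2 * ∑' n, ‖u (n + 1)‖ ^ 2)
    (fun _ => by positivity) fun N => ?_
  refine le_trans ?_ (key N)
  exact sum_le_sum_of_subset_of_nonneg (range_mono (Nat.le_succ N)) fun _ _ _ => by positivity

/-- The solution of the three-term recurrence with initial values `0` and `1`. -/
noncomputable def jacobiSolution (c b : ℕ → ℝ) (z : ℂ) : ℕ → ℂ
  | 0 => 0
  | 1 => 1
  | n + 2 => ((z - b n) * jacobiSolution c b z (n + 1) - c n * jacobiSolution c b z n) / c (n + 1)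

theorem jacobiSolution_rec {c : ℕ → ℝ} (hc : ∀ n, 0 < c n) (b : ℕ → ℝ) (z : ℂ) (n : ℕ) :
    z * jacobiSolution c b z (n + 1) = c n * jacobiSolution c b z n
      + b n * jacobiSolution c b z (n + 1) + c (n + 1) * jacobiSolution c b z (n + 2) := by
  have h : (c (n + 1) : ℂ) ≠ 0 := by exact_mod_cast (hc (n + 1)).ne'
  rw [jacobiSolution, mul_div_cancel₀ _ h]
  ring

/-- The sum of `f` over the descendants of `x` lying `n` levels below `x`. -/
def levelSum {d : ℕ} {E : Type*} [AddCommMonoid E] (f : List (Fin d) → E) (x : List (Fin d))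
    (n : ℕ) : E :=
  ∑ w : Fin n → Fin d, f (x ++ List.ofFn w)

theorem levelSum_zero {d : ℕ} {E : Type*} [AddCommMonoid E] (f : List (Fin d) → E)
    (x : List (Fin d)) : levelSum f x 0 = f x := by
  simp [levelSum]

theorem levelSum_succ {d : ℕ} {E : Type*} [AddCommMonoid E] (f : List (Fin d) → E)
    (x : List (Fin d)) (n : ℕ) :
    levelSum f x (n + 1) = levelSum (fun y => ∑ i, f (y ++ [i])) x n := by
  unfold levelSum
  rw [← (Fin.snocEquiv fun _ => Fin d).sum_comp, Fintype.sum_prod_type_right]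
  simp only [Fin.snocEquiv_apply, List.ofFn_succ', Fin.snoc_castSucc, Fin.snoc_last,
    List.append_assoc, List.concat_eq_append]

theorem summable_levelSum {d : ℕ} {f : List (Fin d) → ℝ} (hf : Summable f) (x : List (Fin d)) :
    Summable (levelSum f x) := by
  have h1 : Summable fun y => f (x ++ y) :=
    hf.comp_injective (List.append_right_injective x)
  have h2 := ((List.equivSigmaTuple (α := Fin d)).symm.summable_iff.mpr h1).sigma
  refine h2.congr fun n => ?_
  simp [levelSum, tsum_fintype, List.equivSigmaTuple]

theorem norm_levelSum_sq_le {d : ℕ} (f : List (Fin d) → ℂ) (x : List (Fin d)) (n : ℕ) :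
    ‖levelSum f x n‖ ^ 2 ≤ (d : ℝ) ^ n * levelSum (fun y => ‖f y‖ ^ 2) x n := by
  unfold levelSum
  calc ‖∑ w : Fin n → Fin d, f (x ++ List.ofFn w)‖ ^ 2
      ≤ (∑ w : Fin n → Fin d, ‖f (x ++ List.ofFn w)‖) ^ 2 := by
        gcongr
        exact norm_sum_le _ _
    _ ≤ _ := by
        refine sq_sum_le_card_mul_sum_sq.trans_eq ?_
        simp

/-- A nonnegative radial function is summable on the tree once its level sums are summable. -/
theorem summable_radial {d : ℕ} {g : ℕ → ℝ} (hg : ∀ n, 0 ≤ g n)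
    (hs : Summable fun n => (d : ℝ) ^ n * g n) :
    Summable fun x : List (Fin d) => g x.length := by
  rw [← (List.equivSigmaTuple (α := Fin d)).symm.summable_iff]
  refine (summable_sigma_of_nonneg fun _ => hg _).mpr ⟨fun _ => Summable.of_finite, ?_⟩
  simpa [tsum_fintype, List.equivSigmaTuple] using hs

section EigenEquation

variable {d : ℕ} {lam beta : ℕ → ℝ} {z : ℂ} {v : List (Fin d) → ℂ}

theorem JacobiEq.levelSum_zero_eq (hv : JacobiEq d lam beta z v) {x : List (Fin d)}
    (hx : x ≠ [] → v x.dropLast = 0) :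
    z * levelSum v x 0 = beta x.length * levelSum v x 0 + lam x.length * levelSum v x 1 := by
  have h := hv x
  have h0 : (if x = [] then 0 else (lam (x.length - 1) : ℂ) * v x.dropLast) = 0 := by
    split_ifs with h
    · rfl
    · rw [hx h, mul_zero]
  rw [jacobiOp, h0, zero_add] at h
  rw [levelSum_succ, levelSum_zero, levelSum_zero, h]

theorem JacobiEq.levelSum_succ_eq (hv : JacobiEq d lam beta z v) (x : List (Fin d)) (n : ℕ) :
    z * levelSum v x (n + 1) = lam (x.length + n) * (d * levelSum v x n)
      + beta (x.length + (n + 1)) * levelSum v x (n + 1)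
      + lam (x.length + (n + 1)) * levelSum v x (n + 2) := by
  have hd : (d : ℂ) * levelSum v x n = levelSum (fun y => v y.dropLast) x (n + 1) := by
    rw [levelSum_succ]
    simp [levelSum, Finset.mul_sum]
  rw [levelSum_succ v x (n + 1), hd]
  unfold levelSum
  simp only [Finset.mul_sum (s := (Finset.univ : Finset (Fin (n + 1) → Fin d))),
    ← Finset.sum_add_distrib]
  refine Finset.sum_congr rfl fun w _ => ?_
  rw [hv, jacobiOp, if_neg (by simp)]
  simp [← add_assoc]

/-- The normalized level sums below `x`, preceded by `0`. -/
noncomputable def radialPart (v : List (Fin d) → ℂ) (x : List (Fin d)) : ℕ → ℂ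
  | 0 => 0
  | n + 1 => levelSum v x n / (Real.sqrt d : ℂ) ^ n

theorem JacobiEq.radialPart_rec (hd : 0 < d) (hv : JacobiEq d lam beta z v) {x : List (Fin d)}
    (hx : x ≠ [] → v x.dropLast = 0) (n : ℕ) :
    z * radialPart v x (n + 1) = (Real.sqrt d * lam (n + x.length - 1) : ℝ) * radialPart v x n
      + beta (n + x.length) * radialPart v x (n + 1)
      + (Real.sqrt d * lam (n + 1 + x.length - 1) : ℝ) * radialPart v x (n + 2) := by
  have hr : (Real.sqrt d : ℂ) ≠ 0 := by
    exact_mod_cast (Real.sqrt_pos.mpr (by exact_mod_cast hd : (0 : ℝ) < d)).ne'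
  have hrd : (d : ℂ) = (Real.sqrt d : ℂ) ^ 2 := by
    exact_mod_cast (Real.sq_sqrt (Nat.cast_nonneg d)).symm
  cases n with
  | zero =>
    have h := hv.levelSum_zero_eq hx
    have hi : 0 + 1 + x.length - 1 = x.length := by omega
    rw [hi]
    simp only [radialPart, zero_add, pow_zero, div_one, mul_zero, pow_one]
    push_cast
    rw [h]
    field_simp
  | succ n =>
    have h := hv.levelSum_succ_eq x n
    have hi : n + 1 + x.length - 1 = x.length + n := by omega
    have hj : n + 1 + 1 + x.length - 1 = x.length + (n + 1) := by omega
    have hk : n + 1 + x.length = x.length + (n + 1) := by omega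
    rw [hi, hj, hk]
    simp only [radialPart]
    push_cast
    rw [hrd] at h
    rw [← mul_div_assoc, h]
    field_simp
    ring

theorem summable_radialPart (hd : 0 < d) (hv : Summable fun x => ‖v x‖ ^ 2) (x : List (Fin d)) :
    Summable fun n => ‖radialPart v x (n + 1)‖ ^ 2 := by
  refine Summable.of_nonneg_of_le (fun _ => by positivity) (fun n => ?_) (summable_levelSum hv x)
  have hd' : (0 : ℝ) < d := by exact_mod_cast hd
  have hn : ‖(Real.sqrt d : ℂ) ^ n‖ ^ 2 = (d : ℝ) ^ n := by
    rw [norm_pow, Complex.norm_real, Real.norm_of_nonneg (Real.sqrt_nonneg _), ← pow_mul,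
      mul_comm, pow_mul, Real.sq_sqrt hd'.le]
  rw [radialPart, norm_div, div_pow, hn, div_le_iff₀ (by positivity), mul_comm]
  exact norm_levelSum_sq_le v x n

/-- A nonzero function on the tree is nonzero at a vertex whose predecessor, if any, is a zero. -/
theorem exists_ne_zero_of_dropLast_eq_zero (hv : ∃ x, v x ≠ 0) :
    ∃ x, v x ≠ 0 ∧ (x ≠ [] → v x.dropLast = 0) := by
  obtain ⟨y, hy⟩ := hv
  induction y using List.reverseRecOn with
  | nil => exact ⟨[], hy, fun h => absurd rfl h⟩
  | append_singleton l i ih =>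
    by_cases h : v l = 0
    · exact ⟨l ++ [i], hy, fun _ => by simpa using h⟩
    · exact ih h

/-- A solution of the one-dimensional recurrence lifts to a radial solution on the tree. -/
theorem jacobiEq_radial (hd : 0 < d) {a : ℕ → ℂ}
    (ha : ∀ n : ℕ, z * a n =
      (if n = 0 then 0 else ((Real.sqrt d * lam (n - 1) : ℝ) : ℂ) * a (n - 1))
        + (beta n : ℂ) * a n + ((Real.sqrt d * lam n : ℝ) : ℂ) * a (n + 1)) :
    JacobiEq d lam beta z fun x => a x.length / (Real.sqrt d : ℂ) ^ x.length := by
  have hr : (Real.sqrt d : ℂ) ≠ 0 := by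
    exact_mod_cast (Real.sqrt_pos.mpr (by exact_mod_cast hd : (0 : ℝ) < d)).ne'
  have hrd : (d : ℂ) = (Real.sqrt d : ℂ) ^ 2 := by
    exact_mod_cast (Real.sq_sqrt (Nat.cast_nonneg d)).symm
  intro x
  have h := ha x.length
  simp only [jacobiOp, List.length_append, List.length_singleton, List.length_dropLast,
    Finset.sum_const, Finset.card_univ, Fintype.card_fin, nsmul_eq_mul]
  rw [← mul_div_assoc, h, hrd]
  push_cast
  cases hn : x.length with
  | zero =>
    have hx : x = [] := List.length_eq_zero_iff.mp hn
    simp only [hx, if_true, pow_zero, zero_add, pow_one]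
    field_simp
  | succ n =>
    have hx : x ≠ [] := by
      rintro rfl
      simp at hn
    simp only [hx, if_false, Nat.succ_ne_zero, Nat.add_sub_cancel]
    field_simp
    ring

end EigenEquation

/-- For nonreal `z`, there is a nonzero square-summable solution of `Jv = z·v`
on the tree `Γ_d` if and only if there is a nonzero square-summable solution of
the one-dimensional recurrence `z·a_n = √d·λ_{n-1}·a_{n-1} + β_n·a_n + √d·λ_n·a_{n+1}`
(with `a_{-1} = 0`), i.e. the deficiency space of `J` is nontrivial iff that of
the classical Jacobi matrix `J^r` is. -/
theorem stmt2 (d : ℕ) (hd : 2 ≤ d) (lam beta : ℕ → ℝ) (hlam : ∀ n, 0 < lam n)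
    (z : ℂ) (hz : z.im ≠ 0) :
    (∃ v : lp (fun _ : List (Fin d) => ℂ) 2,
       v ≠ 0 ∧ JacobiEq d lam beta z (fun x => v x))
    ↔ (∃ a : ℕ → ℂ, a ≠ 0 ∧ Summable (fun n => ‖a n‖ ^ 2) ∧
        ∀ n : ℕ,
          z * a n =
            (if n = 0 then 0 else ((Real.sqrt d * lam (n - 1) : ℝ) : ℂ) * a (n - 1))
              + (beta n : ℂ) * a n + ((Real.sqrt d * lam n : ℝ) : ℂ) * a (n + 1)) := by
  have hd0 : 0 < d := by omega
  have hdr : (0 : ℝ) < d := by exact_mod_cast hd0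
  have hr : 0 < Real.sqrt d := Real.sqrt_pos.mpr hdr
  constructor
  · rintro ⟨v, hv0, hv⟩
    have hvs : Summable fun x => ‖v x‖ ^ 2 := by
      simpa using (lp.memℓp v).summable (by norm_num)
    have hex : ∃ x, v x ≠ 0 := by
      by_contra! h
      exact hv0 (lp.ext (funext h))
    obtain ⟨x, hx, hxp⟩ := exists_ne_zero_of_dropLast_eq_zero (v := fun x => v x) hex
    set c : ℕ → ℝ := fun n => Real.sqrt d * lam (n - 1) with hc
    have hrec := jacobiSolution_rec (c := c) (fun n => mul_pos hr (hlam _)) beta z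
    set p := jacobiSolution c beta z with hp
    have hp1 : p 1 = 1 := by rw [hp, jacobiSolution]
    have hp0 : p 0 = 0 := by rw [hp, jacobiSolution]
    have hshift := jacobi_summable_of_summable hz (c := fun n => c (n + x.length))
      (b := fun n => beta (n + x.length)) (a := fun n => p (n + x.length))
      (hv.radialPart_rec hd0 hxp) rfl (by simpa [radialPart, levelSum_zero] using hx)
      (summable_radialPart hd0 hvs x) (fun n => by
        simpa only [Nat.add_right_comm n _ x.length] using hrec (n + x.length))
    refine ⟨fun n => p (n + 1), fun h => ?_, ?_, fun n => ?_⟩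
    · have := congrFun h 0
      simp [hp1] at this
    · rw [← summable_nat_add_iff x.length]
      simpa only [Nat.add_right_comm _ x.length 1] using hshift
    · rw [hrec n]
      cases n with
      | zero => simp [hp0, hc]
      | succ n => simp [hc]
  · rintro ⟨a, ha0, has, ha⟩
    have hmem : Memℓp (fun x : List (Fin d) => a x.length / (Real.sqrt d : ℂ) ^ x.length) 2 := by
      refine memℓp_gen ?_
      have hs := summable_radial (d := d) (g := fun n => ‖a n / (Real.sqrt d : ℂ) ^ n‖ ^ 2)
        (fun _ => by positivity) (by
          refine has.congr fun n => ?_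
          rw [norm_div, norm_pow, Complex.norm_real, Real.norm_of_nonneg hr.le, div_pow,
            ← pow_mul, mul_comm n 2, pow_mul, Real.sq_sqrt hdr.le]
          field_simp)
      simpa using hs
    refine ⟨⟨_, hmem⟩, fun h => ha0 (funext fun n => ?_), jacobiEq_radial hd0 ha⟩
    have h1 := congrFun (congrArg (fun f : lp (fun _ : List (Fin d) => ℂ) 2 => (f : _ → ℂ)) h)
      (List.replicate n ⟨0, hd0⟩)
    have hrc : (Real.sqrt d : ℂ) ≠ 0 := by exact_mod_cast hr.ne'
    simpa [hrc, hd0.ne'] using h1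
end

section
/- Let z ∈ ℂ. Suppose v : Γ_d → ℂ is radial, v(e) = 1, and v satisfies the Jacobi eigen-equation Jv = z·v at every vertex of Γ_d. Then v(x) = p_{|x|}(z)/√(d^{|x|}) for every vertex x, and Σ_{x ∈ Γ_d} |v(x)|² = Σ_{n=0}^∞ |p_n(z)|² (as an equality of values in [0, ∞]). -/
/-- Summing a function of the word length over all words, grouped by length. -/
theorem tsum_list_length {α : Type*} [Fintype α] (f : ℕ → ENNReal) :
    ∑' x : List α, f x.length = ∑' n : ℕ, (Fintype.card α : ENNReal) ^ n * f n := by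
  rw [← (Equiv.sigmaFiberEquiv (List.length (α := α))).tsum_eq, ENNReal.tsum_sigma']
  refine tsum_congr fun n => ?_
  have hconst : ∀ x : {l : List α // l.length = n},
      f ((Equiv.sigmaFiberEquiv (List.length (α := α))) ⟨n, x⟩).length = f n :=
    fun x => congrArg f x.2
  simp_rw [hconst]
  change ∑' _ : List.Vector α n, f n = _
  rw [tsum_fintype, Finset.sum_const, Finset.card_univ, card_vector, nsmul_eq_mul, Nat.cast_pow]

/-- Two solutions of the radial recurrences on `Γ_d` and on `ℕ` which agree at `0` differ
by the factor `√d ^ n`. -/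
theorem eq_sqrt_pow_mul_of_recurrence {d : ℕ} (hd : 0 < d) {lam beta : ℕ → ℝ}
    (hlam : ∀ n, 0 < lam n) {z : ℂ} {p w : ℕ → ℂ} (h0 : p 0 = w 0)
    (hp : ∀ n : ℕ,
      z * p n = (if n = 0 then 0 else ((Real.sqrt d * lam (n - 1) : ℝ) : ℂ) * p (n - 1))
        + (beta n : ℂ) * p n + ((Real.sqrt d * lam n : ℝ) : ℂ) * p (n + 1))
    (hw : ∀ n : ℕ,
      z * w n = (if n = 0 then 0 else (lam (n - 1) : ℂ) * w (n - 1))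
        + (beta n : ℂ) * w n + (lam n : ℂ) * (d * w (n + 1))) (n : ℕ) :
    p n = ((Real.sqrt d : ℝ) : ℂ) ^ n * w n := by
  have hsq : ((Real.sqrt d : ℝ) : ℂ) ^ 2 = d := by
    rw [← Complex.ofReal_pow, Real.sq_sqrt d.cast_nonneg, Complex.ofReal_natCast]
  have hs : ((Real.sqrt d : ℝ) : ℂ) ≠ 0 :=
    Complex.ofReal_ne_zero.2 (Real.sqrt_pos.2 (Nat.cast_pos.2 hd)).ne'
  have hl : ∀ n, (lam n : ℂ) ≠ 0 := fun n => Complex.ofReal_ne_zero.2 (hlam n).ne'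
  push_cast at hp
  generalize ((Real.sqrt d : ℝ) : ℂ) = s at *
  induction n using Nat.twoStepInduction with
  | zero => simpa using h0
  | one =>
    have hp' := hp 0
    have hw' := hw 0
    simp only [if_true, zero_add] at hp' hw'
    refine mul_left_cancel₀ (mul_ne_zero hs (hl 0)) ?_
    rw [← hsq] at hw'
    rw [h0] at hp'
    linear_combination hw' - hp'
  | more n ih ih' =>
    have hp' := hp (n + 1)
    have hw' := hw (n + 1)
    simp only [Nat.add_eq_zero_iff, one_ne_zero, and_false, if_false, Nat.add_sub_cancel]
      at hp' hw'
    refine mul_left_cancel₀ (mul_ne_zero hs (hl (n + 1))) ?_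
    rw [← hsq] at hw'
    rw [ih, ih'] at hp'
    linear_combination s ^ (n + 1) * hw' - hp'

/-- If `v` is radial, `v(e) = 1`, and `v` solves `Jv = z·v` at every vertex of `Γ_d`,
then `v(x) = p_{|x|}(z)/√(d^{|x|})` where `p_n` are the orthogonal polynomials of the
radial Jacobi matrix `J^r`, and `Σ_x |v(x)|² = Σ_n |p_n(z)|²` in `[0,∞]`. -/
theorem stmt7 (d : ℕ) (hd : 2 ≤ d) (lam beta : ℕ → ℝ) (hlam : ∀ n, 0 < lam n)
    (z : ℂ) (p : ℕ → ℂ) (hp0 : p 0 = 1)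
    (hprec : ∀ n : ℕ,
      z * p n = (if n = 0 then 0 else ((Real.sqrt d * lam (n - 1) : ℝ) : ℂ) * p (n - 1))
        + (beta n : ℂ) * p n + ((Real.sqrt d * lam n : ℝ) : ℂ) * p (n + 1))
    (v : List (Fin d) → ℂ) (hrad : Radial d v) (hve : v [] = 1)
    (hv : ∀ x : List (Fin d), z * v x = jacobiOp d lam beta v x) :
    (∀ x : List (Fin d), v x = p x.length / ((Real.sqrt (d ^ x.length) : ℝ) : ℂ)) ∧
    ∑' x : List (Fin d), ((‖v x‖₊ : ENNReal) ^ 2)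
      = ∑' n : ℕ, ((‖p n‖₊ : ENNReal) ^ 2) := by
  have hd0 : 0 < d := by omega
  let w : ℕ → ℂ := fun n => v (List.replicate n ⟨0, hd0⟩)
  have hvw : ∀ x, v x = w x.length := fun x => hrad _ _ (by simp)
  have hw : ∀ n : ℕ,
      z * w n = (if n = 0 then 0 else (lam (n - 1) : ℂ) * w (n - 1))
        + (beta n : ℂ) * w n + (lam n : ℂ) * (d * w (n + 1)) := by
    intro n
    have h := hv (List.replicate n ⟨0, hd0⟩)
    simpa [jacobiOp, hvw] using h
  have hpw := eq_sqrt_pow_mul_of_recurrence hd0 hlam (hp0.trans hve.symm) hprec hw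
  have hs : 0 < Real.sqrt d := Real.sqrt_pos.2 (Nat.cast_pos.2 hd0)
  refine ⟨fun x => ?_, ?_⟩
  · have hpow : Real.sqrt ((d : ℝ) ^ x.length) = Real.sqrt d ^ x.length := by
      rw [Real.sqrt_eq_iff_mul_self_eq (by positivity) (by positivity), ← mul_pow,
        Real.mul_self_sqrt d.cast_nonneg]
    rw [hpow, hpw, hvw, Complex.ofReal_pow, mul_div_cancel_left₀]
    exact pow_ne_zero _ (Complex.ofReal_ne_zero.2 hs.ne')
  · simp_rw [hvw]
    rw [tsum_list_length fun n => (‖w n‖₊ : ENNReal) ^ 2, Fintype.card_fin]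
    refine tsum_congr fun n => ?_
    have hnorm : ‖p n‖₊ ^ 2 = (d : NNReal) ^ n * ‖w n‖₊ ^ 2 := by
      apply NNReal.eq
      push_cast
      rw [hpw, norm_mul, norm_pow, Complex.norm_real, Real.norm_of_nonneg hs.le, mul_pow,
        pow_right_comm, Real.sq_sqrt d.cast_nonneg]
    exact_mod_cast congrArg ((↑) : NNReal → ENNReal) hnorm.symm
end
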